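/- arXiv:1703.08834 — 2 statements merged into one kernel-verified Lean document; each statement's English description precedes it below -/
import Mathlib

section
/- Suppose n is not a product of two primes and n = p_1^{α_1} p_2^{α_2} ⋯ p_r^{α_r}, where r ≥ 2, p_1 < p_2 < ⋯ < p_r are primes and α_i ∈ ℕ. Then for all 1 ≤ j < k ≤ r, |∪_{i=1, i≠k}^{r} ⟨\overline{p_i p_k}⟩| ≤ |∪_{i=1, i≠j}^{r} ⟨\overline{p_i p_j}⟩|. -/
open SimpleGraph

/-- The power graph of a (multiplicative) group: distinct `x, y` are adjacent
iff one is a power of the other. -/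
def powerGraph (G : Type*) [Group G] : SimpleGraph G where
  Adj x y := x ≠ y ∧ (x ∈ Subgroup.zpowers y ∨ y ∈ Subgroup.zpowers x)
  symm := by
    constructor
    rintro x y ⟨h1, h2⟩
    exact ⟨h1.symm, h2.symm⟩
  loopless := by
    constructor
    rintro x ⟨h1, -⟩
    exact h1 rfl

/-- The power graph of the additive group `ℤ_n`. -/
def powerGraphZ (n : ℕ) : SimpleGraph (ZMod n) where
  Adj x y := x ≠ y ∧ (x ∈ AddSubgroup.zmultiples y ∨ y ∈ AddSubgroup.zmultiples x)
  symm := by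
    constructor
    rintro x y ⟨h1, h2⟩
    exact ⟨h1.symm, h2.symm⟩
  loopless := by
    constructor
    rintro x ⟨h1, -⟩
    exact h1 rfl

/-- Number of connected components of a graph. -/
noncomputable def numComponents {V : Type*} (Γ : SimpleGraph V) : ℕ :=
  Nat.card Γ.ConnectedComponent

/-- `T` is a separating set of `Γ`: deleting `T` increases the number of components. -/
def IsSepSet {V : Type*} (Γ : SimpleGraph V) (T : Set V) : Prop :=
  numComponents Γ < numComponents (Γ.induce Tᶜ)

/-- A separating set is minimal if no nonempty proper subset of it is separating. -/
def IsMinimalSepSet {V : Type*} (Γ : SimpleGraph V) (T : Set V) : Prop :=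
  IsSepSet Γ T ∧ ∀ S : Set V, S ⊆ T → S ≠ T → S.Nonempty → ¬ IsSepSet Γ S

/-- A separating set of least cardinality. -/
def IsMinimumSepSet {V : Type*} (Γ : SimpleGraph V) (T : Set V) : Prop :=
  IsSepSet Γ T ∧ ∀ S : Set V, IsSepSet Γ S → T.ncard ≤ S.ncard

/-- Vertex connectivity: the least number of vertices whose removal leaves a
disconnected or one-vertex graph. -/
noncomputable def kappa {V : Type*} (Γ : SimpleGraph V) : ℕ :=
  sInf {k | ∃ S : Set V, S.ncard = k ∧
    (¬ (Γ.induce Sᶜ).Preconnected ∨ (Sᶜ : Set V).ncard = 1)}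

/-- `𝒮(ℤ_n)`: the identity together with the generators of `ℤ_n`. -/
def genSet (n : ℕ) : Set (ZMod n) :=
  {x | AddSubgroup.zmultiples x = ⊤} ∪ {0}

/-- `ℤ̃_n = ℤ_n − 𝒮(ℤ_n)`. -/
def tildeVerts (n : ℕ) : Set (ZMod n) := (genSet n)ᶜ

/-- `𝒢̃(ℤ_n)`: the subgraph of the power graph induced on `ℤ̃_n`. -/
def tildeGraph (n : ℕ) : SimpleGraph (tildeVerts n) :=
  (powerGraphZ n).induce (tildeVerts n)

/-- The `≈`-class of `x`: elements generating the same cyclic subgroup. -/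
def simClass {G : Type*} [Group G] (x : G) : Set G :=
  {y | Subgroup.zpowers y = Subgroup.zpowers x}

/-- The `≈`-class in `ℤ_n`. -/
def simClassZ {n : ℕ} (x : ZMod n) : Set (ZMod n) :=
  {y | AddSubgroup.zmultiples y = AddSubgroup.zmultiples x}

/-- Neighbourhood of a set of vertices: vertices adjacent to some element of `A`,
excluding `A` itself. -/
def setNbhd {V : Type*} (Γ : SimpleGraph V) (A : Set V) : Set V :=
  (⋃ a ∈ A, Γ.neighborSet a) \ A

/-- The proper power graph: the power graph with the identity removed. -/
def properPowerGraph (G : Type*) [Group G] : SimpleGraph ({g : G | g ≠ 1}) :=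
  (powerGraph G).induce {g : G | g ≠ 1}

theorem aux_mem (n d : ℕ) [NeZero n] (hd : d ∣ n) (x : ZMod n) :
    x ∈ AddSubgroup.zmultiples ((d : ℕ) : ZMod n) ↔ d ∣ x.val := by
  rw [AddSubgroup.mem_zmultiples_iff]
  constructor
  · rintro ⟨c, rfl⟩
    have h : (ZMod.castHom hd (ZMod d)) (c • ((d : ℕ) : ZMod n)) = 0 := by
      rw [map_zsmul, map_natCast]; simp
    rw [← ZMod.natCast_eq_zero_iff, ← h]
    rw [ZMod.castHom_apply, ← ZMod.natCast_val]
  · rintro ⟨c, hc⟩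
    refine ⟨c, ?_⟩
    rw [← ZMod.natCast_zmod_val x, hc]
    push_cast
    simp [mul_comm]

theorem aux_union (n k : ℕ) (hk : k ∈ n.primeFactors) [NeZero n] (x : ZMod n) :
    x ∈ (⋃ i ∈ n.primeFactors.erase k,
        ((AddSubgroup.zmultiples (((i * k : ℕ) : ZMod n)) : Set (ZMod n)))) ↔
    k ∣ x.val ∧ ∃ i ∈ n.primeFactors, i ≠ k ∧ i ∣ x.val := by
  have key : ∀ i ∈ n.primeFactors, i ≠ k → ∀ m : ℕ, (i * k ∣ m ↔ i ∣ m ∧ k ∣ m) := by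
    intro i hi hik m
    have hc : Nat.Coprime i k := (Nat.coprime_primes (Nat.prime_of_mem_primeFactors hi)
      (Nat.prime_of_mem_primeFactors hk)).2 hik
    exact ⟨fun h => ⟨(Dvd.intro _ rfl).trans h, (Dvd.intro_left _ rfl).trans h⟩,
      fun h => hc.mul_dvd_of_dvd_of_dvd h.1 h.2⟩
  simp only [Set.mem_iUnion, Finset.mem_erase, exists_prop, SetLike.mem_coe]
  constructor
  · rintro ⟨i, ⟨hik, hi⟩, hx⟩
    rw [aux_mem _ _ ((key i hi hik n).2 ⟨Nat.dvd_of_mem_primeFactors hi,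
      Nat.dvd_of_mem_primeFactors hk⟩), key i hi hik] at hx
    exact ⟨hx.2, i, hi, hik, hx.1⟩
  · rintro ⟨hkx, i, hi, hik, hx⟩
    refine ⟨i, ⟨hik, hi⟩, ?_⟩
    rw [aux_mem _ _ ((key i hi hik n).2 ⟨Nat.dvd_of_mem_primeFactors hi,
      Nat.dvd_of_mem_primeFactors hk⟩), key i hi hik]
    exact ⟨hx, hkx⟩

/-- If `n` has at least two prime factors and is not a product of two
primes, then for prime factors `j < k` of `n`,
`|∪_{i ≠ k} ⟨\overline{i·k}⟩| ≤ |∪_{i ≠ j} ⟨\overline{i·j}⟩|`. -/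
theorem stmt6 (n : ℕ) (hn : 2 ≤ n.primeFactors.card)
    (hn2 : ¬ ∃ p q : ℕ, p.Prime ∧ q.Prime ∧ n = p * q) :
    ∀ j ∈ n.primeFactors, ∀ k ∈ n.primeFactors, j < k →
      (⋃ i ∈ n.primeFactors.erase k,
        ((AddSubgroup.zmultiples (((i * k : ℕ) : ZMod n)) : Set (ZMod n)))).ncard
      ≤ (⋃ i ∈ n.primeFactors.erase j,
        ((AddSubgroup.zmultiples (((i * j : ℕ) : ZMod n)) : Set (ZMod n)))).ncard := by
  intro j hj k hk hjk
  have hn0 : n ≠ 0 := by rintro rfl; simp at hj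
  have : NeZero n := ⟨hn0⟩
  have hjp := Nat.prime_of_mem_primeFactors hj
  have hkp := Nat.prime_of_mem_primeFactors hk
  let T : ℕ → Set (ZMod n) := fun d =>
    {x | d ∣ x.val ∧ ∃ i ∈ n.primeFactors, i ≠ j ∧ i ≠ k ∧ i ∣ x.val}
  let D : Set (ZMod n) := {x | j ∣ x.val ∧ k ∣ x.val}
  have e1 : (⋃ i ∈ n.primeFactors.erase k,
        ((AddSubgroup.zmultiples (((i * k : ℕ) : ZMod n)) : Set (ZMod n)))) = T k ∪ D := by
    ext x
    rw [aux_union n k hk]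
    simp only [T, D, Set.mem_union, Set.mem_ofPred_eq]
    constructor
    · rintro ⟨h, i, hi, hik, hx⟩
      by_cases hij : i = j
      · subst hij; exact Or.inr ⟨hx, h⟩
      · exact Or.inl ⟨h, i, hi, hij, hik, hx⟩
    · rintro (⟨h, i, hi, hij, hik, hx⟩ | ⟨h1, h2⟩)
      · exact ⟨h, i, hi, hik, hx⟩
      · exact ⟨h2, j, hj, hjk.ne, h1⟩
  have e2 : (⋃ i ∈ n.primeFactors.erase j,
        ((AddSubgroup.zmultiples (((i * j : ℕ) : ZMod n)) : Set (ZMod n)))) = T j ∪ D := by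
    ext x
    rw [aux_union n j hj]
    simp only [T, D, Set.mem_union, Set.mem_ofPred_eq]
    constructor
    · rintro ⟨h, i, hi, hij, hx⟩
      by_cases hik : i = k
      · subst hik; exact Or.inr ⟨h, hx⟩
      · exact Or.inl ⟨h, i, hi, hij, hik, hx⟩
    · rintro (⟨h, i, hi, hij, hik, hx⟩ | ⟨h1, h2⟩)
      · exact ⟨h, i, hi, hij, hx⟩
      · exact ⟨h1, k, hk, hjk.ne', h2⟩
  rw [e1, e2]
  have e3 : T k ∩ D = T j ∩ D := by
    ext x
    simp only [T, D, Set.mem_inter_iff, Set.mem_ofPred_eq]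
    exact ⟨fun h => ⟨⟨h.2.1, h.1.2⟩, h.2⟩, fun h => ⟨⟨h.2.2, h.1.2⟩, h.2⟩⟩
  have c1 := Set.ncard_union_add_ncard_inter (T k) D
  have c2 := Set.ncard_union_add_ncard_inter (T j) D
  have hv : ∀ x : ZMod n, k ∣ x.val →
      (((x.val / k * j : ℕ) : ZMod n)).val = x.val / k * j := by
    intro x hx
    apply ZMod.val_cast_of_lt
    calc x.val / k * j ≤ x.val / k * k := Nat.mul_le_mul_left _ hjk.le
      _ = x.val := Nat.div_mul_cancel hx
      _ < n := ZMod.val_lt x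
  have c3 : (T k).ncard ≤ (T j).ncard := by
    apply Set.ncard_le_ncard_of_injOn (fun x : ZMod n => ((x.val / k * j : ℕ) : ZMod n))
    · rintro x ⟨h, i, hi, hij, hik, hx⟩
      simp only [T, Set.mem_ofPred_eq]
      rw [hv x h]
      refine ⟨Dvd.intro_left _ rfl, i, hi, hij, hik, Dvd.dvd.mul_right ?_ _⟩
      have hip := Nat.prime_of_mem_primeFactors hi
      rw [← Nat.div_mul_cancel h] at hx
      exact Nat.Coprime.dvd_of_dvd_mul_right ((Nat.coprime_primes hip hkp).2 hik) hx
    · rintro x ⟨hx, -⟩ y ⟨hy, -⟩ hxy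
      have h := congrArg ZMod.val hxy
      simp only at h
      rw [hv x hx, hv y hy] at h
      have h2 := Nat.eq_of_mul_eq_mul_right hjp.pos h
      apply ZMod.val_injective n
      rw [← Nat.div_mul_cancel hx, ← Nat.div_mul_cancel hy, h2]
  rw [e3] at c1
  omega
end

section
/- Suppose n ∈ ℕ is not a product of two primes and n = p_1^{α_1} p_2^{α_2} ⋯ p_r^{α_r}, where r ≥ 2, p_1 < p_2 < ⋯ < p_r are primes and α_i ∈ ℕ. Then for each 1 ≤ k ≤ r with α_k > 1 and each 1 ≤ β_k < α_k, the set Ñ([\overline{p_k^{β_k}}]) is a separating set of 𝒢̃(ℤ_n) but is not a minimal separating set of 𝒢̃(ℤ_n). -/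
open SimpleGraph

lemma mem_zm {n : ℕ} (x y : ZMod n) : y ∈ AddSubgroup.zmultiples x ↔ x ∣ y := by
  rw [AddSubgroup.mem_zmultiples_iff]
  constructor
  · rintro ⟨k, rfl⟩
    exact ⟨(k : ZMod n), by rw [zsmul_eq_mul, mul_comm]⟩
  · rintro ⟨c, rfl⟩
    obtain ⟨k, rfl⟩ := ZMod.intCast_surjective c
    exact ⟨k, by rw [zsmul_eq_mul, mul_comm]⟩

lemma zm_eq {n : ℕ} (x y : ZMod n) :
    AddSubgroup.zmultiples x = AddSubgroup.zmultiples y ↔ x ∣ y ∧ y ∣ x := by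
  rw [le_antisymm_iff, AddSubgroup.zmultiples_le, AddSubgroup.zmultiples_le, mem_zm, mem_zm,
    and_comm]

lemma adj_iff {n : ℕ} (x y : ZMod n) : (powerGraphZ n).Adj x y ↔ x ≠ y ∧ (y ∣ x ∨ x ∣ y) := by
  change _ ∧ _ ↔ _
  rw [mem_zm, mem_zm]

lemma mem_tilde {n : ℕ} (x : ZMod n) : x ∈ tildeVerts n ↔ ¬ x ∣ 1 ∧ x ≠ 0 := by
  have : AddSubgroup.zmultiples x = ⊤ ↔ x ∣ 1 := by
    rw [AddSubgroup.eq_top_iff']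
    constructor
    · intro h; exact (mem_zm _ _).1 (h 1)
    · intro h y; exact (mem_zm _ _).2 (h.trans (one_dvd y))
  simp [tildeVerts, genSet, this, not_or]
  tauto

lemma cast_dvd {n d a : ℕ} (hd : d ∣ n) : ((d : ZMod n) ∣ (a : ZMod n)) ↔ d ∣ a := by
  constructor
  · rintro ⟨c, hc⟩
    obtain ⟨k, rfl⟩ := ZMod.intCast_surjective c
    have h : ((a : ℤ) : ZMod n) = ((d * k : ℤ) : ZMod n) := by push_cast; exact hc
    rw [ZMod.intCast_eq_intCast_iff_dvd_sub] at h
    have h1 : (d : ℤ) ∣ d * k - a := (Int.natCast_dvd_natCast.2 hd).trans h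
    have h2 : (d : ℤ) ∣ a := (dvd_sub_right (dvd_mul_right _ _)).1 h1
    exact_mod_cast h2
  · exact fun h => Nat.cast_dvd_cast h

lemma exists_div {n : ℕ} [NeZero n] (z : ZMod n) : ∃ g : ℕ, g ∣ n ∧ (g : ZMod n) ∣ z ∧ z ∣ g := by
  refine ⟨Nat.gcd z.val n, Nat.gcd_dvd_right _ _, ?_, ?_⟩
  · conv_rhs => rw [← ZMod.natCast_zmod_val z]
    exact Nat.cast_dvd_cast (Nat.gcd_dvd_left _ _)
  · have h := Nat.gcd_eq_gcd_ab z.val n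
    have h' := congrArg (Int.cast : ℤ → ZMod n) h
    push_cast at h'
    rw [ZMod.natCast_zmod_val, ZMod.natCast_self, zero_mul, add_zero] at h'
    exact ⟨_, h'⟩

lemma mem_nb {n : ℕ} (x z : ZMod n) : z ∈ setNbhd (powerGraphZ n) (simClassZ x) ↔
    (z ∣ x ∨ x ∣ z) ∧ ¬ (z ∣ x ∧ x ∣ z) := by
  simp only [setNbhd, simClassZ, Set.mem_diff, Set.mem_iUnion, Set.mem_setOf_eq, zm_eq,
    SimpleGraph.mem_neighborSet, adj_iff, exists_prop]
  constructor
  · rintro ⟨⟨a, ⟨h1, h2⟩, -, h | h⟩, h3⟩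
    · exact ⟨Or.inl (h.trans h1), h3⟩
    · exact ⟨Or.inr (h2.trans h), h3⟩
  · rintro ⟨h, h3⟩
    refine ⟨⟨x, ⟨dvd_rfl, dvd_rfl⟩, ?_, h⟩, h3⟩
    rintro rfl
    exact h3 ⟨dvd_rfl, dvd_rfl⟩

lemma cast_tilde {n d p : ℕ} (hp : p.Prime) (hpn : p ∣ n) (hpd : p ∣ d) (h0 : ¬ n ∣ d) :
    (d : ZMod n) ∈ tildeVerts n := by
  rw [mem_tilde]
  refine ⟨fun h => ?_, fun h => h0 ((ZMod.natCast_eq_zero_iff _ _).1 h)⟩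
  have h1 : (p : ZMod n) ∣ ((1 : ℕ) : ZMod n) := by
    rw [Nat.cast_one]; exact (Nat.cast_dvd_cast hpd).trans h
  rw [cast_dvd hpn] at h1
  exact hp.one_lt.ne' (Nat.dvd_one.1 h1)

lemma adj_reach {n : ℕ} (x y : tildeVerts n) (h : (x : ZMod n) ∣ y) :
    (tildeGraph n).Reachable x y := by
  by_cases hxy : x = y
  · rw [hxy]
  · apply SimpleGraph.Adj.reachable
    change (powerGraphZ n).Adj x y
    rw [adj_iff]
    exact ⟨fun h' => hxy (Subtype.ext h'), Or.inr h⟩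

lemma tilde_preconn (n : ℕ) (hn : 2 ≤ n.primeFactors.card)
    (hn2 : ¬ ∃ p q : ℕ, p.Prime ∧ q.Prime ∧ n = p * q) : (tildeGraph n).Preconnected := by
  have hn0 : n ≠ 0 := by rintro rfl; simp at hn
  have : NeZero n := ⟨hn0⟩
  have hnp : ∀ p : ℕ, p.Prime → ¬ n ∣ p := by
    intro p hp h
    rcases (Nat.dvd_prime hp).1 h with h | h
    · rw [h] at hn; simp at hn
    · rw [h, hp.primeFactors] at hn; simp at hn
  have key : ∀ x : tildeVerts n, ∃ p : ℕ, p.Prime ∧ p ∣ n ∧ (p : ZMod n) ∣ x := by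
    intro x
    obtain ⟨g, h1, h2, h3⟩ := exists_div (x : ZMod n)
    have hg : g ≠ 1 := by
      rintro rfl
      exact ((mem_tilde _).1 x.2).1 (by simpa using h3)
    obtain ⟨p, hp, hpg⟩ := Nat.exists_prime_and_dvd hg
    exact ⟨p, hp, hpg.trans h1, (Nat.cast_dvd_cast hpg).trans h2⟩
  intro x y
  obtain ⟨p, hp, hpn, hpx⟩ := key x
  obtain ⟨q, hq, hqn, hqy⟩ := key y
  have tp := cast_tilde hp hpn dvd_rfl (hnp p hp)
  have tq := cast_tilde hq hqn dvd_rfl (hnp q hq)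
  have hx := adj_reach ⟨_, tp⟩ x hpx
  have hy := adj_reach ⟨_, tq⟩ y hqy
  refine hx.symm.trans (SimpleGraph.Reachable.trans ?_ hy)
  by_cases hpq : p = q
  · subst hpq; exact SimpleGraph.Reachable.refl _
  have hd : p * q ∣ n := Nat.Coprime.mul_dvd_of_dvd_of_dvd ((Nat.coprime_primes hp hq).2 hpq) hpn hqn
  have tpq := cast_tilde (n := n) (d := p * q) hp hpn (dvd_mul_right _ _)
    (fun h => hn2 ⟨p, q, hp, hq, Nat.dvd_antisymm h hd⟩)
  have r1 := adj_reach ⟨_, tp⟩ ⟨_, tpq⟩ (Nat.cast_dvd_cast (dvd_mul_right _ _))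
  have r2 := adj_reach ⟨_, tq⟩ ⟨_, tpq⟩ (Nat.cast_dvd_cast (dvd_mul_left _ _))
  exact r1.trans r2.symm

lemma not_reach {V : Type*} (Γ : SimpleGraph V) (A : Set V)
    (hA : ∀ u v, Γ.Adj u v → u ∈ A → v ∈ A) (u v : V) (h : Γ.Reachable u v) (hu : u ∈ A) :
    v ∈ A := by
  obtain ⟨w⟩ := h
  induction w with
  | nil => exact hu
  | cons h _ ih => exact ih (hA _ _ h hu)

lemma sep_of {V : Type*} [Finite V] (Γ : SimpleGraph V) (hΓ : Γ.Preconnected) (T : Set V)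
    (A : Set V) (hA : ∀ u v, u ∉ T → v ∉ T → Γ.Adj u v → u ∈ A → v ∈ A)
    (x y : V) (hx : x ∉ T) (hy : y ∉ T) (hxA : x ∈ A) (hyA : y ∉ A) : IsSepSet Γ T := by
  unfold IsSepSet numComponents
  have h1 : Nat.card Γ.ConnectedComponent ≤ 1 := by
    have := hΓ.subsingleton_connectedComponent
    exact Finite.card_le_one_iff_subsingleton.2 this
  refine lt_of_le_of_lt h1 ?_
  rw [Finite.one_lt_card_iff_nontrivial]
  refine ⟨(Γ.induce Tᶜ).connectedComponentMk ⟨x, hx⟩, (Γ.induce Tᶜ).connectedComponentMk ⟨y, hy⟩,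
    fun h => ?_⟩
  rw [SimpleGraph.ConnectedComponent.eq] at h
  exact hyA (not_reach (Γ.induce Tᶜ) {u | u.1 ∈ A} (fun u v huv hu => hA u v u.2 v.2 huv hu) _ _ h hxA)

/-- If `n` has at least two prime factors and is not a product of two
primes, then for each prime factor `k` of `n` with multiplicity `α_k > 1` and each
`1 ≤ β_k < α_k`, the set `Ñ([\overline{k^{β_k}}])` is a separating set of
`𝒢̃(ℤ_n)` but not a minimal one. -/
theorem stmt11 (n : ℕ) (hn : 2 ≤ n.primeFactors.card)
    (hn2 : ¬ ∃ p q : ℕ, p.Prime ∧ q.Prime ∧ n = p * q) :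
    ∀ k ∈ n.primeFactors, 1 < n.factorization k →
      ∀ β : ℕ, 1 ≤ β → β < n.factorization k →
        IsSepSet (tildeGraph n)
          (Subtype.val ⁻¹'
            (setNbhd (powerGraphZ n) (simClassZ (((k ^ β : ℕ) : ZMod n))) \ genSet n)) ∧
        ¬ IsMinimalSepSet (tildeGraph n)
          (Subtype.val ⁻¹'
            (setNbhd (powerGraphZ n) (simClassZ (((k ^ β : ℕ) : ZMod n))) \ genSet n)) := by
  intro k hk hα1 β hβ1 hβ
  have hn0 : n ≠ 0 := by rintro rfl; simp at hn
  have : NeZero n := ⟨hn0⟩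
  have : Finite (tildeVerts n) := inferInstance
  have hkp : k.Prime := Nat.prime_of_mem_primeFactors hk
  have hkn : k ∣ n := Nat.dvd_of_mem_primeFactors hk
  obtain ⟨q, hq, hqk⟩ := Finset.exists_mem_ne (s := n.primeFactors) hn k
  have hqp : q.Prime := Nat.prime_of_mem_primeFactors hq
  have hqn : q ∣ n := Nat.dvd_of_mem_primeFactors hq
  set α := n.factorization k with hα
  have hαn : k ^ α ∣ n := Nat.ordProj_dvd n k
  have hβα : k ^ β ∣ k ^ α := pow_dvd_pow _ hβ.le
  have hβn : k ^ β ∣ n := hβα.trans hαn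
  have hqpow : ∀ j, ¬ q ∣ k ^ j := fun j h =>
    hqk ((Nat.prime_dvd_prime_iff_eq hqp hkp).1 (hqp.dvd_of_dvd_pow h))
  have hkq : ¬ k ∣ q := fun h => hqk ((Nat.prime_dvd_prime_iff_eq hkp hqp).1 h).symm
  have hnot : ¬ k ^ α ∣ k ^ β := fun h =>
    absurd ((Nat.pow_dvd_pow_iff_le_right hkp.one_lt).1 h) (by omega)
  have tpow : ∀ j, 1 ≤ j → ((k ^ j : ℕ) : ZMod n) ∈ tildeVerts n := fun j hj =>
    cast_tilde hkp hkn (dvd_pow_self k (by omega)) (fun h => hqpow j (hqn.trans h))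
  have tq : ((q : ℕ) : ZMod n) ∈ tildeVerts n :=
    cast_tilde hqp hqn dvd_rfl (fun h => hkq (hkn.trans h))
  have tβq : ((k ^ β * q : ℕ) : ZMod n) ∈ tildeVerts n := by
    refine cast_tilde hqp hqn (dvd_mul_left _ _) (fun h => hnot ?_)
    exact Nat.Coprime.dvd_of_dvd_mul_right
      (((Nat.coprime_primes hkp hqp).2 hqk.symm).pow_left α) (hαn.trans h)
  have hgen : ∀ z : tildeVerts n, (z : ZMod n) ∉ genSet n := fun z => z.2
  have dq : ∀ j, 1 ≤ j → k ^ j ∣ n → ¬ ((k ^ j : ℕ) : ZMod n) ∣ (q : ZMod n) := by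
    intro j hj h1 h
    exact hkq ((dvd_pow_self k (by omega)).trans ((cast_dvd h1).1 h))
  have qd : ∀ j, ¬ (q : ZMod n) ∣ ((k ^ j : ℕ) : ZMod n) := fun j h =>
    hqpow j ((cast_dvd hqn).1 h)
  have dβα : ((k ^ β : ℕ) : ZMod n) ∣ ((k ^ α : ℕ) : ZMod n) := Nat.cast_dvd_cast hβα
  have comp : ∀ z : ZMod n, z ∣ ((k ^ α : ℕ) : ZMod n) →
      z ∣ ((k ^ β : ℕ) : ZMod n) ∨ ((k ^ β : ℕ) : ZMod n) ∣ z := by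
    intro z hz
    obtain ⟨g, h1, h2, h3⟩ := exists_div z
    have h4 : g ∣ k ^ α := (cast_dvd h1).1 (h2.trans hz)
    obtain ⟨j, -, rfl⟩ := (Nat.dvd_prime_pow hkp).1 h4
    rcases le_total j β with h | h
    · exact Or.inl (h3.trans (Nat.cast_dvd_cast (pow_dvd_pow _ h)))
    · exact Or.inr ((Nat.cast_dvd_cast (pow_dvd_pow _ h) :
        ((k ^ β : ℕ) : ZMod n) ∣ ((k ^ j : ℕ) : ZMod n)).trans h2)
  have hpre := tilde_preconn n hn hn2
  have sep : ∀ T : Set (tildeVerts n),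
      T ⊆ (Subtype.val ⁻¹'
        (setNbhd (powerGraphZ n) (simClassZ (((k ^ β : ℕ) : ZMod n))) \ genSet n)) →
      (∀ z : tildeVerts n,
        (z : ZMod n) ∈ setNbhd (powerGraphZ n) (simClassZ (((k ^ β : ℕ) : ZMod n))) → z ∉ T →
        (z : ZMod n) ∣ ((k ^ α : ℕ) : ZMod n) ∧ ((k ^ α : ℕ) : ZMod n) ∣ z) →
      IsSepSet (tildeGraph n) T := by
    intro T hT1 hT2
    refine sep_of _ hpre T
      {z | ((z : ZMod n) ∣ ((k ^ β : ℕ) : ZMod n) ∧ ((k ^ β : ℕ) : ZMod n) ∣ z) ∨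
        ((z : ZMod n) ∣ ((k ^ α : ℕ) : ZMod n) ∧ ((k ^ α : ℕ) : ZMod n) ∣ z)} ?_
      ⟨_, tpow β hβ1⟩ ⟨_, tq⟩ ?_ ?_ ?_ ?_
    · intro u v hu hv huv hA
      have huv' : (powerGraphZ n).Adj u v := huv
      rw [adj_iff] at huv'
      have hc : (v : ZMod n) ∣ ((k ^ β : ℕ) : ZMod n) ∨ ((k ^ β : ℕ) : ZMod n) ∣ v := by
        rcases hA with ⟨a1, a2⟩ | ⟨a1, a2⟩ <;> rcases huv'.2 with h | h
        · exact Or.inl (h.trans a1)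
        · exact Or.inr (a2.trans h)
        · exact comp _ (h.trans a1)
        · exact Or.inr (dβα.trans (a2.trans h))
      by_cases hcl : (v : ZMod n) ∣ ((k ^ β : ℕ) : ZMod n) ∧ ((k ^ β : ℕ) : ZMod n) ∣ v
      · exact Or.inl hcl
      · exact Or.inr (hT2 v ((mem_nb _ _).2 ⟨hc, hcl⟩) hv)
    · intro h
      exact ((mem_nb _ _).1 (hT1 h).1).2 ⟨dvd_rfl, dvd_rfl⟩
    · intro h
      rcases ((mem_nb _ _).1 (hT1 h).1).1 with h | h
      · exact qd β h
      · exact dq β hβ1 hβn h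
    · exact Or.inl ⟨dvd_rfl, dvd_rfl⟩
    · rintro (⟨h, -⟩ | ⟨h, -⟩)
      · exact qd β h
      · exact qd α h
  refine ⟨sep _ subset_rfl (fun z hz hz' => absurd ⟨hz, hgen z⟩ hz'), ?_⟩
  rintro ⟨-, hmin⟩
  have hqd : (q : ZMod n) ∣ ((k ^ β * q : ℕ) : ZMod n) := Nat.cast_dvd_cast (dvd_mul_left _ _)
  refine hmin ((Subtype.val ⁻¹'
        (setNbhd (powerGraphZ n) (simClassZ (((k ^ β : ℕ) : ZMod n))) \ genSet n)) \
        {z | (z : ZMod n) ∣ ((k ^ α : ℕ) : ZMod n) ∧ ((k ^ α : ℕ) : ZMod n) ∣ z})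
    Set.diff_subset ?_ ?_ (sep _ Set.diff_subset ?_)
  · intro heq
    have hm : (⟨_, tpow α (by omega)⟩ : tildeVerts n) ∈ (Subtype.val ⁻¹'
        (setNbhd (powerGraphZ n) (simClassZ (((k ^ β : ℕ) : ZMod n))) \ genSet n)) :=
      ⟨(mem_nb _ _).2 ⟨Or.inr dβα, fun h => hnot ((cast_dvd hαn).1 h.1)⟩, hgen _⟩
    rw [← heq] at hm
    exact hm.2 ⟨dvd_rfl, dvd_rfl⟩
  · refine ⟨⟨_, tβq⟩, ⟨(mem_nb _ _).2 ⟨Or.inr (Nat.cast_dvd_cast (dvd_mul_right _ _)),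
      fun h => qd β (hqd.trans h.1)⟩, hgen _⟩, fun h => qd α (hqd.trans h.1)⟩
  · intro z hz hz'
    by_contra hc
    exact hz' ⟨⟨hz, hgen z⟩, hc⟩
end
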